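/- arXiv:1402.3384 — 2 statements merged into one kernel-verified Lean document; each statement's English description precedes it below -/
import Mathlib

section
/- Under the mechanism E, the absolute-error distortion of the companion estimator q̂^u_φ satisfies: for every database x ∈ D^n, E_{Y∼E(x)}[|q̂^u_φ(Y) − q_φ(x)|] ≤ (b−a)(1+(2^l−1)e^{−ε}) / (c(1−e^{−ε})·√n). -/
open Finset

abbrev Row (l : ℕ) := Fin l → Bool
abbrev Db (l n : ℕ) := Fin n → Row l

/-- Hamming distance on `D^n`. -/
def ham {l n : ℕ} (x y : Db l n) : ℕ :=
  (Finset.univ.filter fun i => x i ≠ y i).card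

/-- The pmf of the mechanism `E` on input `x`. -/
noncomputable def pE (l : ℕ) (ε : ℝ) {n : ℕ} (x y : Db l n) : ℝ :=
  Real.exp (-ε * (ham x y : ℝ)) / (1 + ((2:ℝ) ^ l - 1) * Real.exp (-ε)) ^ n

/-- `a_i = min_{v ∈ D} φ_i(v)`. -/
noncomputable def Amin {l n : ℕ} (φ : Fin n → Row l → ℝ) (i : Fin n) : ℝ :=
  Finset.univ.inf' Finset.univ_nonempty (φ i)

/-- `b_i = max_{v ∈ D} φ_i(v)`. -/
noncomputable def Bmax {l n : ℕ} (φ : Fin n → Row l → ℝ) (i : Fin n) : ℝ :=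
  Finset.univ.sup' Finset.univ_nonempty (φ i)

/-- The statistical query `q_φ(x) = (∑ i φ_i(x_i)) / (∑ i c_i)` with `c_i = b_i - a_i`. -/
noncomputable def qS {l n : ℕ} (φ : Fin n → Row l → ℝ) (x : Db l n) : ℝ :=
  (∑ i, φ i (x i)) / (∑ i, (Bmax φ i - Amin φ i))

/-- `C_φ = (∑ i ∑ v φ_i(v)) / (∑ i c_i)`. -/
noncomputable def Cphi {l n : ℕ} (φ : Fin n → Row l → ℝ) : ℝ :=
  (∑ i, ∑ v : Row l, φ i v) / (∑ i, (Bmax φ i - Amin φ i))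

/-- The unbiased companion estimator
`q̂ᵘ_φ(y) = (g(ε)/(1-e^{-ε})) q_φ(y) - (e^{-ε}/(1-e^{-ε})) C_φ` where `g(ε)=1+(2^l-1)e^{-ε}`. -/
noncomputable def qhatu {l n : ℕ} (ε : ℝ) (φ : Fin n → Row l → ℝ) (y : Db l n) : ℝ :=
  ((1 + ((2:ℝ) ^ l - 1) * Real.exp (-ε)) / (1 - Real.exp (-ε))) * qS φ y
    - (Real.exp (-ε) / (1 - Real.exp (-ε))) * Cphi φ

/-- The second moment of a sum of independent, centred, bounded variables, for a product weight. -/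
theorem sum_prod_mul_sum_sq_le {ι V : Type*} [Fintype ι] [DecidableEq ι] [Fintype V]
    (w f : ι → V → ℝ) (hw : ∀ i v, 0 ≤ w i v) (hw1 : ∀ i, ∑ v, w i v = 1)
    (hf : ∀ i, ∑ v, w i v * f i v = 0) (K : ℝ) (hK : ∀ i v, |f i v| ≤ K) :
    ∑ y : ι → V, (∏ i, w i (y i)) * (∑ i, f i (y i)) ^ 2 ≤ Fintype.card ι * K ^ 2 := by
  have htotal : ∑ y : ι → V, ∏ i, w i (y i) = 1 := by
    rw [← Fintype.prod_sum]
    simp [hw1]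
  have hcross : ∀ i j, i ≠ j →
      ∑ y : ι → V, (∏ k, w k (y k)) * (f i (y i) * f j (y j)) = 0 := by
    intro i j hij
    have hprod : ∀ y : ι → V, (∏ k, w k (y k)) * (f i (y i) * f j (y j)) =
        ∏ k, (w k (y k) * ((if k = i then f k (y k) else 1) *
          (if k = j then f k (y k) else 1))) := by
      intro y
      simp only [Finset.prod_mul_distrib, Finset.prod_ite_eq', Finset.mem_univ, if_true]
    simp_rw [hprod]
    rw [← Fintype.prod_sum fun k v => w k v * ((if k = i then f k v else 1) *
      (if k = j then f k v else 1))]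
    exact Finset.prod_eq_zero (Finset.mem_univ i) (by simp [hij, hf])
  have hdiag : ∀ i, ∑ y : ι → V, (∏ k, w k (y k)) * (f i (y i) * f i (y i)) ≤ K ^ 2 := by
    intro i
    calc ∑ y : ι → V, (∏ k, w k (y k)) * (f i (y i) * f i (y i))
        ≤ ∑ y : ι → V, (∏ k, w k (y k)) * K ^ 2 := by
          refine Finset.sum_le_sum fun y _ => mul_le_mul_of_nonneg_left ?_
            (Finset.prod_nonneg fun k _ => hw k _)
          rw [← pow_two]
          exact sq_le_sq.2 ((hK i (y i)).trans (le_abs_self K))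
      _ = K ^ 2 := by rw [← Finset.sum_mul, htotal, one_mul]
  calc ∑ y : ι → V, (∏ i, w i (y i)) * (∑ i, f i (y i)) ^ 2
      = ∑ i, ∑ j, ∑ y : ι → V, (∏ k, w k (y k)) * (f i (y i) * f j (y j)) := by
        simp_rw [pow_two, Finset.sum_mul_sum, Finset.mul_sum]
        rw [Finset.sum_comm]
        exact Finset.sum_congr rfl fun i _ => Finset.sum_comm
    _ = ∑ i, ∑ y : ι → V, (∏ k, w k (y k)) * (f i (y i) * f i (y i)) :=
        Finset.sum_congr rfl fun i _ =>
          Finset.sum_eq_single i (fun j _ hj => hcross i j hj.symm) (by simp)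
    _ ≤ ∑ _i : ι, K ^ 2 := Finset.sum_le_sum fun i _ => hdiag i
    _ = Fintype.card ι * K ^ 2 := by simp

/-- The squared mean of `|X|` is at most the mean of `X ^ 2`. -/
theorem sq_sum_mul_abs_le {α : Type*} [Fintype α] (p X : α → ℝ) (hp : ∀ y, 0 ≤ p y)
    (hp1 : ∑ y, p y = 1) : (∑ y, p y * |X y|) ^ 2 ≤ ∑ y, p y * X y ^ 2 := by
  have h := Finset.sum_sq_le_sum_mul_sum_of_sq_le_mul Finset.univ (r := fun y => p y * |X y|)
    (fun y _ => hp y) (fun y _ => mul_nonneg (hp y) (sq_nonneg (X y)))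
    (fun y _ => by rw [mul_pow, sq_abs]; exact le_of_eq (by ring))
  rwa [hp1, one_mul] at h

/-- The distribution of a single output row of the mechanism `E` on the input row `u`. -/
noncomputable def rowWeight (l : ℕ) (ε : ℝ) (u v : Row l) : ℝ :=
  (if v = u then 1 else Real.exp (-ε)) / (1 + ((2 : ℝ) ^ l - 1) * Real.exp (-ε))

theorem normalizer_pos (l : ℕ) (ε : ℝ) : 0 < 1 + ((2 : ℝ) ^ l - 1) * Real.exp (-ε) := by
  have h : (1 : ℝ) ≤ 2 ^ l := one_le_pow₀ (by norm_num)
  have := mul_nonneg (sub_nonneg.2 h) (Real.exp_pos (-ε)).le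
  linarith

theorem rowWeight_nonneg (l : ℕ) (ε : ℝ) (u v : Row l) : 0 ≤ rowWeight l ε u v := by
  have := normalizer_pos l ε
  unfold rowWeight
  split_ifs <;> positivity

theorem sum_rowWeight_mul (l : ℕ) (ε : ℝ) (u : Row l) (f : Row l → ℝ) :
    ∑ v, rowWeight l ε u v * f v =
      ((1 - Real.exp (-ε)) * f u + Real.exp (-ε) * ∑ v, f v) /
        (1 + ((2 : ℝ) ^ l - 1) * Real.exp (-ε)) := by
  have h : ∀ v, rowWeight l ε u v * f v =
      ((if v = u then (1 - Real.exp (-ε)) * f v else 0) + Real.exp (-ε) * f v) /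
        (1 + ((2 : ℝ) ^ l - 1) * Real.exp (-ε)) := by
    intro v
    unfold rowWeight
    split_ifs <;> ring
  simp_rw [h]
  rw [← Finset.sum_div, Finset.sum_add_distrib, Finset.mul_sum]
  simp

theorem sum_rowWeight (l : ℕ) (ε : ℝ) (u : Row l) : ∑ v, rowWeight l ε u v = 1 := by
  have h := sum_rowWeight_mul l ε u fun _ => 1
  have hcard : (∑ _v : Row l, (1 : ℝ)) = 2 ^ l := by simp
  simp only [mul_one, hcard] at h
  rw [h, div_eq_one_iff_eq (normalizer_pos l ε).ne']
  ring

theorem pE_eq_prod (l : ℕ) (ε : ℝ) {n : ℕ} (x y : Db l n) :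
    pE l ε x y = ∏ i, rowWeight l ε (x i) (y i) := by
  simp only [pE, rowWeight, Finset.prod_div_distrib, Finset.prod_const, Finset.card_univ,
    Fintype.card_fin]
  congr 1
  rw [Finset.prod_ite]
  simp only [Finset.prod_const, one_pow, one_mul, ham]
  rw [mul_comm, Real.exp_nat_mul]
  simp only [ne_eq, eq_comm]

/-- A value and a weighted mean of a function with values in `[a, b]` are at distance
at most `b - a`. -/
theorem abs_sub_weighted_mean_le {V : Type*} [Fintype V] (w f : V → ℝ) (hw : ∀ v, 0 ≤ w v)
    (hw1 : ∑ v, w v = 1) (a b : ℝ) (ha : ∀ v, a ≤ f v) (hb : ∀ v, f v ≤ b) (v : V) :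
    |f v - ∑ u, w u * f u| ≤ b - a := by
  have h1 : a ≤ ∑ u, w u * f u := by
    calc a = ∑ u, w u * a := by rw [← Finset.sum_mul, hw1, one_mul]
      _ ≤ _ := Finset.sum_le_sum fun u _ => mul_le_mul_of_nonneg_left (ha u) (hw u)
  have h2 : ∑ u, w u * f u ≤ b := by
    calc ∑ u, w u * f u ≤ ∑ u, w u * b :=
          Finset.sum_le_sum fun u _ => mul_le_mul_of_nonneg_left (hb u) (hw u)
      _ = b := by rw [← Finset.sum_mul, hw1, one_mul]
  rw [abs_le]
  constructor <;> linarith [ha v, hb v]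

theorem qhatu_sub_qS (l n : ℕ) (ε : ℝ) (hε : 0 < ε) (φ : Fin n → Row l → ℝ) (x y : Db l n) :
    qhatu ε φ y - qS φ x =
      (1 + ((2 : ℝ) ^ l - 1) * Real.exp (-ε)) / (1 - Real.exp (-ε)) /
        (∑ i, (Bmax φ i - Amin φ i)) *
        ∑ i, (φ i (y i) - ∑ v, rowWeight l ε (x i) v * φ i v) := by
  have hg := (normalizer_pos l ε).ne'
  have he : 1 - Real.exp (-ε) ≠ 0 := (sub_pos.2 (Real.exp_lt_one_iff.2 (neg_lt_zero.2 hε))).ne'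
  simp only [sum_rowWeight_mul, Finset.sum_sub_distrib, ← Finset.sum_div,
    Finset.sum_add_distrib, ← Finset.mul_sum, qhatu, qS, Cphi]
  generalize 1 + ((2 : ℝ) ^ l - 1) * Real.exp (-ε) = g at *
  generalize (∑ i, Bmax φ i - ∑ i, Amin φ i) = S at *
  rw [div_eq_mul_inv _ S, div_eq_mul_inv _ S, div_eq_mul_inv _ S, div_eq_mul_inv _ S]
  generalize S⁻¹ = T
  field_simp
  ring

/-- Under the mechanism `E`, the absolute-error distortion of `q̂ᵘ_φ` satisfies
`E_{Y∼E(x)}[|q̂ᵘ_φ(Y) - q_φ(x)|] ≤ (b-a)(1+(2^l-1)e^{-ε})/(c(1-e^{-ε})√n)`. -/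
theorem stmt6 (l n : ℕ) (hl : 1 ≤ l) (hn : 1 ≤ n) (ε : ℝ) (hε : 0 < ε)
    (φ : Fin n → Row l → ℝ) (a b c : ℝ) (hc : 0 < c)
    (hq : ∀ i, a ≤ Amin φ i ∧ Amin φ i < Bmax φ i ∧ Bmax φ i ≤ b ∧
      c ≤ Bmax φ i - Amin φ i)
    (x : Db l n) :
    (∑ y : Db l n, pE l ε x y * |qhatu ε φ y - qS φ x|)
      ≤ (b - a) * (1 + ((2:ℝ) ^ l - 1) * Real.exp (-ε))
          / (c * (1 - Real.exp (-ε)) * Real.sqrt n) := by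
  have hg := normalizer_pos l ε
  have he : 0 < 1 - Real.exp (-ε) := sub_pos.2 (Real.exp_lt_one_iff.2 (neg_lt_zero.2 hε))
  have hn' : (0 : ℝ) < n := by exact_mod_cast hn
  have hab : 0 ≤ b - a := by
    obtain ⟨h1, h2, h3, -⟩ := hq ⟨0, hn⟩
    linarith
  have hS : n * c ≤ ∑ i, (Bmax φ i - Amin φ i) := by
    calc n * c = ∑ _i : Fin n, c := by simp
      _ ≤ _ := Finset.sum_le_sum fun i _ => (hq i).2.2.2
  set w : Fin n → Row l → ℝ := fun i => rowWeight l ε (x i)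
  set f : Fin n → Row l → ℝ := fun i v => φ i v - ∑ u, w i u * φ i u with hf_def
  have hw : ∀ i v, 0 ≤ w i v := fun i => rowWeight_nonneg l ε (x i)
  have hw1 : ∀ i, ∑ v, w i v = 1 := fun i => sum_rowWeight l ε (x i)
  have hf : ∀ i, ∑ v, w i v * f i v = 0 := by
    intro i
    simp only [hf_def, mul_sub, Finset.sum_sub_distrib]
    rw [← Finset.sum_mul, hw1, one_mul, sub_self]
  have hK : ∀ i v, |f i v| ≤ b - a := fun i v =>
    abs_sub_weighted_mean_le (w i) (φ i) (hw i) (hw1 i) a b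
      (fun u => (hq i).1.trans (Finset.inf'_le _ (Finset.mem_univ u)))
      (fun u => (Finset.le_sup' (φ i) (Finset.mem_univ u)).trans (hq i).2.2.1) v
  have hmean : ∑ y : Db l n, (∏ i, w i (y i)) * |∑ i, f i (y i)| ≤ Real.sqrt n * (b - a) := by
    refine abs_le_of_sq_le_sq' ?_ (by positivity) |>.2
    calc (∑ y : Db l n, (∏ i, w i (y i)) * |∑ i, f i (y i)|) ^ 2
        ≤ ∑ y : Db l n, (∏ i, w i (y i)) * (∑ i, f i (y i)) ^ 2 :=
          sq_sum_mul_abs_le _ _ (fun y => Finset.prod_nonneg fun i _ => hw i _)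
            (by rw [← Fintype.prod_sum]; simp [hw1])
      _ ≤ Fintype.card (Fin n) * (b - a) ^ 2 := sum_prod_mul_sum_sq_le w f hw hw1 hf _ hK
      _ = (Real.sqrt n * (b - a)) ^ 2 := by
          rw [mul_pow, Real.sq_sqrt hn'.le, Fintype.card_fin]
  have hnc : 0 < n * c := mul_pos hn' hc
  have hSpos := hnc.trans_le hS
  set g := 1 + ((2 : ℝ) ^ l - 1) * Real.exp (-ε)
  set S := ∑ i, (Bmax φ i - Amin φ i)
  calc ∑ y : Db l n, pE l ε x y * |qhatu ε φ y - qS φ x|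
      = g / (1 - Real.exp (-ε)) / S *
          ∑ y : Db l n, (∏ i, w i (y i)) * |∑ i, f i (y i)| := by
        rw [Finset.mul_sum]
        refine Finset.sum_congr rfl fun y _ => ?_
        rw [pE_eq_prod, qhatu_sub_qS l n ε hε, abs_mul, abs_of_nonneg (by positivity)]
        exact mul_left_comm _ _ _
    _ ≤ g / (1 - Real.exp (-ε)) / (n * c) * (Real.sqrt n * (b - a)) := by
        have hnonneg : 0 ≤ ∑ y : Db l n, (∏ i, w i (y i)) * |∑ i, f i (y i)| :=
          Finset.sum_nonneg fun y _ =>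
            mul_nonneg (Finset.prod_nonneg fun i _ => hw i _) (abs_nonneg _)
        gcongr
    _ = (b - a) * g / (c * (1 - Real.exp (-ε)) * Real.sqrt n) := by
        have hsq : Real.sqrt n ≠ 0 := (Real.sqrt_pos.2 hn').ne'
        nth_rewrite 1 [← Real.sq_sqrt hn'.le]
        field_simp
end

section
/- For every n ≥ 1, the minimax distortion for statistical queries satisfies the upper bound D_{ε,n}^S ≤ 4(b−a)²(1+(2^l−1)e^{−ε})² / (c²(1−e^{−ε})²·n). -/
open Finset

/-- Two databases are neighbors if they differ in exactly one row. -/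
def Neighbor {l n : ℕ} (x x' : Db l n) : Prop :=
  (Finset.univ.filter fun i => x i ≠ x' i).card = 1

/-- `φ` specifies a statistical query with parameters `a, b, c`:
`a ≤ a_i < b_i ≤ b` and `c_i = b_i - a_i ≥ c` for every row `i`. -/
def StatQ {l n : ℕ} (a b c : ℝ) (φ : Fin n → Row l → ℝ) : Prop :=
  ∀ i, a ≤ Amin φ i ∧ Amin φ i < Bmax φ i ∧ Bmax φ i ≤ b ∧ c ≤ Bmax φ i - Amin φ i

/-- The minimax distortion `D_{ε,n}^S` for statistical queries: the infimum over
`ε`-differentially private mechanisms of the supremum over statistical queries of the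
infimum over proper estimators of the worst-case expected squared error. -/
noncomputable def minimaxS (l : ℕ) (ε a b c : ℝ) (n : ℕ) : ℝ :=
  ⨅ M : {p : Db l n → Db l n → ℝ // (∀ x y, 0 ≤ p x y) ∧ (∀ x, ∑ y, p x y = 1) ∧
      ∀ x x', Neighbor x x' → ∀ y, p x y ≤ Real.exp ε * p x' y},
    ⨆ φ : {φ : Fin n → Row l → ℝ // StatQ a b c φ},
      ⨅ q : {q : Db l n → ℝ // ∀ y, ∃ x0, q y = qS φ.1 x0},
        ⨆ x : Db l n, ∑ y, M.1 x y * (q.1 y - qS φ.1 x) ^ 2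

/-- The second moment of a sum of independent centered variables is the sum of the
second moments. -/
lemma sum_prod_mul_sum_sq {ι α : Type*} [Fintype ι] [DecidableEq ι] [Fintype α]
    (r f : ι → α → ℝ) (hr : ∀ i, ∑ v, r i v = 1) (hf : ∀ i, ∑ v, r i v * f i v = 0) :
    ∑ y : ι → α, (∏ i, r i (y i)) * (∑ i, f i (y i)) ^ 2 = ∑ i, ∑ v, r i v * f i v ^ 2 := by
  have factor : ∀ i j, ∑ y : ι → α, (∏ k, r k (y k)) * (f i (y i) * f j (y j)) =
      ∏ k, ∑ v, r k v * ((if k = i then f k v else 1) * (if k = j then f k v else 1)) := by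
    intro i j
    rw [Finset.prod_univ_sum, Fintype.piFinset_univ]
    refine Finset.sum_congr rfl fun y _ => ?_
    simp only [Finset.prod_mul_distrib, Finset.prod_ite_eq', Finset.mem_univ, if_true]
  have moment : ∀ i j, ∑ y : ι → α, (∏ k, r k (y k)) * (f i (y i) * f j (y j)) =
      if i = j then ∑ v, r i v * f i v ^ 2 else 0 := by
    intro i j
    rw [factor]
    split_ifs with h
    · subst h
      rw [Finset.prod_eq_single i (fun k _ hk => by simp [hk, hr]) (by simp)]
      simp [pow_two]
    · exact Finset.prod_eq_zero (Finset.mem_univ i) (by simp [h, hf])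
  calc ∑ y : ι → α, (∏ i, r i (y i)) * (∑ i, f i (y i)) ^ 2
      = ∑ y : ι → α, ∑ i, ∑ j, (∏ k, r k (y k)) * (f i (y i) * f j (y j)) := by
        refine Finset.sum_congr rfl fun y _ => ?_
        rw [pow_two, Finset.sum_mul_sum, Finset.mul_sum]
        exact Finset.sum_congr rfl fun i _ => Finset.mul_sum _ _ _
    _ = ∑ i, ∑ j, ∑ y : ι → α, (∏ k, r k (y k)) * (f i (y i) * f j (y j)) := by
        rw [Finset.sum_comm]
        exact Finset.sum_congr rfl fun i _ => Finset.sum_comm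
    _ = ∑ i, ∑ v, r i v * f i v ^ 2 := by simp [moment]

/-- The normalizing constant `1 + (2^l - 1) e` of a single row. -/
noncomputable def rowNorm (l : ℕ) (e : ℝ) : ℝ := 1 + ((2 : ℝ) ^ l - 1) * e

/-- The randomized response kernel on a single row: the true value has weight `1`,
every other value has weight `e`. -/
noncomputable def rowPmf (l : ℕ) (e : ℝ) (u v : Row l) : ℝ :=
  (if u = v then 1 else e) / rowNorm l e

lemma rowNorm_pos {l : ℕ} {e : ℝ} (he : 0 < e) : 0 < rowNorm l e := by
  have : (1 : ℝ) ≤ 2 ^ l := one_le_pow₀ (by norm_num)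
  unfold rowNorm
  nlinarith [mul_nonneg (sub_nonneg.2 this) he.le]

lemma rowPmf_nonneg {l : ℕ} {e : ℝ} (he : 0 < e) (u v : Row l) : 0 ≤ rowPmf l e u v := by
  have := rowNorm_pos (l := l) he
  unfold rowPmf
  split_ifs <;> positivity

lemma sum_rowPmf_mul {l : ℕ} (e : ℝ) (u : Row l) (F : Row l → ℝ) :
    ∑ v, rowPmf l e u v * F v = ((1 - e) * F u + e * ∑ v, F v) / rowNorm l e := by
  have h : ∀ v, rowPmf l e u v * F v =
      ((if u = v then (1 - e) * F v else 0) + e * F v) / rowNorm l e := by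
    intro v
    unfold rowPmf
    split_ifs <;> ring
  simp_rw [h]
  rw [← Finset.sum_div, Finset.sum_add_distrib, ← Finset.mul_sum]
  simp

lemma sum_rowPmf {l : ℕ} {e : ℝ} (he : 0 < e) (u : Row l) : ∑ v, rowPmf l e u v = 1 := by
  have h := sum_rowPmf_mul e u (fun _ => 1)
  simp only [mul_one] at h
  rw [h, div_eq_one_iff_eq (rowNorm_pos he).ne']
  simp [rowNorm]
  ring

lemma rowPmf_le {l : ℕ} {e : ℝ} (he : 0 < e) (he1 : e < 1) (u u' v : Row l) :
    rowPmf l e u v ≤ e⁻¹ * rowPmf l e u' v := by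
  have hg := rowNorm_pos (l := l) he
  have h1 : 1 < e⁻¹ := (one_lt_inv₀ he).2 he1
  have h2 : e⁻¹ * e = 1 := inv_mul_cancel₀ he.ne'
  unfold rowPmf
  rw [← mul_div_assoc]
  apply div_le_div_of_nonneg_right _ hg.le
  split_ifs <;> nlinarith

/-- Independent randomized response on all rows. -/
noncomputable def dbPmf (l : ℕ) (e : ℝ) {n : ℕ} (x y : Db l n) : ℝ :=
  ∏ i, rowPmf l e (x i) (y i)

lemma dbPmf_nonneg {l n : ℕ} {e : ℝ} (he : 0 < e) (x y : Db l n) : 0 ≤ dbPmf l e x y :=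
  Finset.prod_nonneg fun _ _ => rowPmf_nonneg he _ _

lemma sum_dbPmf {l n : ℕ} {e : ℝ} (he : 0 < e) (x : Db l n) : ∑ y, dbPmf l e x y = 1 := by
  have h := Finset.prod_univ_sum (fun _ : Fin n => (Finset.univ : Finset (Row l)))
    (fun i v => rowPmf l e (x i) v)
  rw [Fintype.piFinset_univ] at h
  simp only [dbPmf, ← h, sum_rowPmf he, Finset.prod_const_one]

lemma dbPmf_le {l n : ℕ} {e : ℝ} (he : 0 < e) (he1 : e < 1) {x x' : Db l n}
    (h : Neighbor x x') (y : Db l n) : dbPmf l e x y ≤ e⁻¹ * dbPmf l e x' y := by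
  obtain ⟨i, hi⟩ := Finset.card_eq_one.1 h
  have hne : ∀ j, j ≠ i → x j = x' j := by
    intro j hj
    by_contra hx
    have : j ∈ ({i} : Finset (Fin n)) := hi ▸ by simp [hx]
    exact hj (by simpa using this)
  unfold dbPmf
  rw [← Finset.mul_prod_erase _ _ (Finset.mem_univ i),
    ← Finset.mul_prod_erase _ (fun i => rowPmf l e (x' i) (y i)) (Finset.mem_univ i), ← mul_assoc,
    Finset.prod_congr rfl fun j hj => by rw [hne j (Finset.ne_of_mem_erase hj)]]
  exact mul_le_mul_of_nonneg_right (rowPmf_le he he1 _ _ _)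
    (Finset.prod_nonneg fun _ _ => rowPmf_nonneg he _ _)

/-- Second-moment bound for the centered single-row unbiased estimator. -/
lemma sum_rowPmf_mul_sq_le {l : ℕ} {e a b : ℝ} (he : 0 < e) (he1 : e < 1) (F : Row l → ℝ)
    (ha : ∀ v, a ≤ F v) (hb : ∀ v, F v ≤ b) (u : Row l) :
    ∑ v, rowPmf l e u v * (rowNorm l e / (1 - e) * F v - e / (1 - e) * ∑ w, F w - F u) ^ 2
      ≤ (rowNorm l e / (1 - e)) ^ 2 * (b - a) ^ 2 := by
  have hg := rowNorm_pos (l := l) he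
  have h1e : 0 < 1 - e := sub_pos.2 he1
  set m : ℝ := ((1 - e) * F u + e * ∑ w, F w) / rowNorm l e with hm
  have hgm : rowNorm l e = (1 - e) + e * 2 ^ l := by unfold rowNorm; ring
  have hsa : 2 ^ l * a ≤ ∑ w, F w := by
    simpa using Finset.card_nsmul_le_sum Finset.univ F a fun v _ => ha v
  have hsb : ∑ w, F w ≤ 2 ^ l * b := by
    simpa using Finset.sum_le_card_nsmul Finset.univ F b fun v _ => hb v
  have hma : a ≤ m := by
    rw [hm, le_div_iff₀ hg, hgm]
    nlinarith [mul_le_mul_of_nonneg_left hsa he.le, mul_le_mul_of_nonneg_left (ha u) h1e.le]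
  have hmb : m ≤ b := by
    rw [hm, div_le_iff₀ hg, hgm]
    nlinarith [mul_le_mul_of_nonneg_left hsb he.le, mul_le_mul_of_nonneg_left (hb u) h1e.le]
  have hterm : ∀ v, (rowNorm l e / (1 - e) * F v - e / (1 - e) * ∑ w, F w - F u) ^ 2
      ≤ (rowNorm l e / (1 - e)) ^ 2 * (b - a) ^ 2 := by
    intro v
    have heq : rowNorm l e / (1 - e) * F v - e / (1 - e) * ∑ w, F w - F u
        = rowNorm l e / (1 - e) * (F v - m) := by
      rw [hm]
      field_simp
      ring
    rw [heq, mul_pow]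
    refine mul_le_mul_of_nonneg_left ?_ (sq_nonneg _)
    exact sq_le_sq' (by linarith [ha v]) (by linarith [hb v])
  calc _ ≤ ∑ v, rowPmf l e u v * ((rowNorm l e / (1 - e)) ^ 2 * (b - a) ^ 2) :=
        Finset.sum_le_sum fun v _ => mul_le_mul_of_nonneg_left (hterm v) (rowPmf_nonneg he _ _)
    _ = _ := by rw [← Finset.sum_mul, sum_rowPmf he, one_mul]

/-- The risk of the unbiased estimator under independent randomized response. -/
lemma sum_dbPmf_mul_qhatu_sub_sq_le {l n : ℕ} {ε a b c : ℝ} (hε : 0 < ε) (hc : 0 < c)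
    (hn : 1 ≤ n) {φ : Fin n → Row l → ℝ} (hφ : StatQ a b c φ) (x : Db l n) :
    ∑ y, dbPmf l (Real.exp (-ε)) x y * (qhatu ε φ y - qS φ x) ^ 2
      ≤ (b - a) ^ 2 * rowNorm l (Real.exp (-ε)) ^ 2 / (c ^ 2 * (1 - Real.exp (-ε)) ^ 2 * n) := by
  have he : 0 < Real.exp (-ε) := Real.exp_pos _
  have he1 : Real.exp (-ε) < 1 := by simpa using hε
  have hunfold : ∀ y, qhatu ε φ y = rowNorm l (Real.exp (-ε)) / (1 - Real.exp (-ε)) * qS φ y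
      - Real.exp (-ε) / (1 - Real.exp (-ε)) * Cphi φ := fun _ => rfl
  set e := Real.exp (-ε)
  have h1e : 0 < 1 - e := sub_pos.2 he1
  have hn0 : (0 : ℝ) < n := by exact_mod_cast hn
  set S : ℝ := ∑ i, (Bmax φ i - Amin φ i) with hS
  have hSn : n * c ≤ S := by
    simpa [hS] using Finset.card_nsmul_le_sum Finset.univ (fun i => Bmax φ i - Amin φ i) c
      fun i _ => (hφ i).2.2.2
  have hnc : 0 < n * c := mul_pos hn0 hc
  have hS0 : 0 < S := hnc.trans_le hSn
  set f : Fin n → Row l → ℝ := fun i v =>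
    rowNorm l e / (1 - e) * φ i v - e / (1 - e) * ∑ w, φ i w - φ i (x i) with hf
  have hdiff : ∀ y, qhatu ε φ y - qS φ x = (∑ i, f i (y i)) / S := by
    intro y
    rw [hunfold]
    simp only [qS, Cphi, ← hS, hf, Finset.sum_sub_distrib, ← Finset.mul_sum]
    ring
  have hcent : ∀ i, ∑ v, rowPmf l e (x i) v * f i v = 0 := by
    intro i
    have hg := rowNorm_pos (l := l) he
    simp only [hf, mul_sub, Finset.sum_sub_distrib, ← Finset.sum_mul, sum_rowPmf he,
      mul_left_comm _ (rowNorm l e / (1 - e)), ← Finset.mul_sum, sum_rowPmf_mul]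
    field_simp
    ring
  have hrow : ∀ i, ∑ v, rowPmf l e (x i) v * f i v ^ 2
      ≤ (rowNorm l e / (1 - e)) ^ 2 * (b - a) ^ 2 := fun i =>
    sum_rowPmf_mul_sq_le he he1 (φ i)
      (fun v => (hφ i).1.trans (Finset.inf'_le _ (Finset.mem_univ v)))
      (fun v => (Finset.le_sup' (φ i) (Finset.mem_univ v)).trans (hφ i).2.2.1) (x i)
  calc ∑ y, dbPmf l e x y * (qhatu ε φ y - qS φ x) ^ 2
      = (∑ i, ∑ v, rowPmf l e (x i) v * f i v ^ 2) / S ^ 2 := by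
        rw [← sum_prod_mul_sum_sq (fun i => rowPmf l e (x i)) f (fun i => sum_rowPmf he _) hcent,
          Finset.sum_div]
        refine Finset.sum_congr rfl fun y _ => ?_
        rw [hdiff, div_pow, mul_div_assoc]
        rfl
    _ ≤ (n * ((rowNorm l e / (1 - e)) ^ 2 * (b - a) ^ 2)) / (n * c) ^ 2 := by
        gcongr
        simpa using Finset.sum_le_card_nsmul Finset.univ _ _ fun i _ => hrow i
    _ = _ := by field_simp

/-- Rounding to a nearest point of the range at most doubles the distance to any point of
the range. -/
lemma exists_proper_estimator {α β : Type*} [Finite β] [Nonempty β] (g : α → ℝ) (q : β → ℝ) :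
    ∃ p : α → ℝ, (∀ y, ∃ x, p y = q x) ∧ ∀ y x, (p y - q x) ^ 2 ≤ 4 * (g y - q x) ^ 2 := by
  choose k hk using fun y => Finite.exists_min fun x => |g y - q x|
  refine ⟨fun y => q (k y), fun y => ⟨k y, rfl⟩, fun y x => ?_⟩
  have h : |q (k y) - q x| ≤ 2 * |g y - q x| := by
    have := abs_sub_le (q (k y)) (g y) (q x)
    rw [abs_sub_comm (q (k y)) (g y)] at this
    linarith [hk y x]
  calc (q (k y) - q x) ^ 2 = |q (k y) - q x| ^ 2 := (sq_abs _).symm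
    _ ≤ (2 * |g y - q x|) ^ 2 := by gcongr
    _ = 4 * (g y - q x) ^ 2 := by rw [mul_pow, sq_abs]; norm_num

/-- Upper bound on the minimax distortion for statistical queries:
`D_{ε,n}^S ≤ 4(b-a)²(1+(2^l-1)e^{-ε})²/(c²(1-e^{-ε})² n)`. -/
theorem stmt8 (l : ℕ) (hl : 1 ≤ l) (ε : ℝ) (hε : 0 < ε) (a b c : ℝ) (hc : 0 < c)
    (n : ℕ) (hn : 1 ≤ n) :
    minimaxS l ε a b c n
      ≤ 4 * (b - a) ^ 2 * (1 + ((2:ℝ) ^ l - 1) * Real.exp (-ε)) ^ 2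
          / (c ^ 2 * (1 - Real.exp (-ε)) ^ 2 * n) := by
  have he : 0 < Real.exp (-ε) := Real.exp_pos _
  have he1 : Real.exp (-ε) < 1 := by simpa using hε
  have risk_nonneg : ∀ (p : Db l n → Db l n → ℝ) (q r : Db l n → ℝ), (∀ x y, 0 ≤ p x y) →
      0 ≤ ⨆ x, ∑ y, p x y * (q y - r x) ^ 2 := fun p q r hp =>
    Real.iSup_nonneg fun x => Finset.sum_nonneg fun y _ => mul_nonneg (hp x y) (sq_nonneg _)
  unfold minimaxS
  refine ciInf_le_of_le ⟨0, ?_⟩ ⟨dbPmf l (Real.exp (-ε)), dbPmf_nonneg he, sum_dbPmf he,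
    fun x x' h y => ?_⟩ ?_
  · rintro _ ⟨M, rfl⟩
    exact Real.iSup_nonneg fun φ => Real.iInf_nonneg fun q => risk_nonneg _ _ _ M.2.1
  · simpa [Real.exp_neg] using dbPmf_le he he1 h y
  refine Real.iSup_le (fun φ => ?_) (by positivity)
  obtain ⟨q, hq, hle⟩ := exists_proper_estimator (qhatu ε φ.1) (qS φ.1)
  refine ciInf_le_of_le ⟨0, ?_⟩ ⟨q, hq⟩ (ciSup_le fun x => ?_)
  · rintro _ ⟨q', rfl⟩
    exact risk_nonneg _ _ _ (dbPmf_nonneg he)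
  calc ∑ y, dbPmf l (Real.exp (-ε)) x y * (q y - qS φ.1 x) ^ 2
      ≤ ∑ y, 4 * (dbPmf l (Real.exp (-ε)) x y * (qhatu ε φ.1 y - qS φ.1 x) ^ 2) := by
        refine Finset.sum_le_sum fun y _ => ?_
        rw [mul_left_comm]
        exact mul_le_mul_of_nonneg_left (hle y x) (dbPmf_nonneg he x y)
    _ ≤ 4 * ((b - a) ^ 2 * rowNorm l (Real.exp (-ε)) ^ 2
          / (c ^ 2 * (1 - Real.exp (-ε)) ^ 2 * n)) := by
        rw [← Finset.mul_sum]
        exact mul_le_mul_of_nonneg_left (sum_dbPmf_mul_qhatu_sub_sq_le hε hc hn φ.2 x) (by norm_num)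
    _ = _ := by rw [rowNorm]; ring
end
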